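/- For n ≥ 2 and ℓ ≥ 0, the number of rooted trees on vertex set {0,1,...,n} rooted at 0 with exactly ℓ doubly record-covering pairs equals Σ_{q=ℓ+2}^{n+1} C(n−1, q−2) · c(q−2, ℓ) · q · (n+1)^(n−q). -/

import Mathlib

def IsRec0 {n : ℕ} (f : Fin (n + 1) → Fin (n + 1)) (v : Fin (n + 1)) : Prop :=
  v ≠ 0 ∧ ∀ k, f^[k] v ≤ v

/-- `R` doubly record-covers `R'`. -/
def DRC {n : ℕ} (f : Fin (n + 1) → Fin (n + 1)) (R R' : Fin (n + 1)) : Prop :=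
  IsRec0 f R ∧ IsRec0 f R' ∧ (∃ k, f^[k] R' = R) ∧ R < R' ∧
    ∀ R'', IsRec0 f R'' → R < R'' → R' ≤ R''

noncomputable def cyclesCount {m : ℕ} (π : Equiv.Perm (Fin m)) : ℕ :=
  π.cycleType.card + (m - π.support.card)

/-- Unsigned Stirling numbers of the first kind. -/
noncomputable def stirC (a b : ℕ) : ℕ :=
  Nat.card {π : Equiv.Perm (Fin a) // cyclesCount π = b}

section Permutations

open Function

theorem card_cycleType_add_eq_card_maxima {α : Type*} [Fintype α] [LinearOrder α]
    (σ : Equiv.Perm α) :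
    σ.cycleType.card + (Fintype.card α - σ.support.card) =
      Nat.card {v : α // ∀ k, σ^[k] v ≤ v} := by
  classical
  rw [Nat.card_eq_fintype_card, Fintype.card_subtype,
    ← Finset.card_filter_add_card_filter_not (s := Finset.univ.filter fun v => ∀ k, σ^[k] v ≤ v)
      (fun v => v ∈ σ.support), ← Finset.card_compl]
  congr 1
  · rw [Equiv.Perm.cycleType_def, Multiset.card_map, Finset.card_val]
    symm
    refine Finset.card_bij (fun v _ => σ.cycleOf v) ?_ ?_ ?_
    · intro v hv
      rw [Equiv.Perm.cycleOf_mem_cycleFactorsFinset_iff]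
      exact (Finset.mem_filter.mp hv).2
    · intro v hv w hw h
      simp only [Finset.mem_filter, Finset.mem_univ, true_and] at hv hw
      have hs := (Equiv.Perm.sameCycle_iff_cycleOf_eq_of_mem_support hv.2 hw.2).mpr h
      obtain ⟨i, -, hi⟩ := hs.exists_pow_eq'
      obtain ⟨j, -, hj⟩ := hs.symm.exists_pow_eq'
      rw [← Equiv.Perm.iterate_eq_pow] at hi hj
      exact le_antisymm (hj ▸ hw.1 j) (hi ▸ hv.1 i)
    · intro c hc
      have hne : c.support.Nonempty :=
        (Equiv.Perm.mem_cycleFactorsFinset_iff.mp hc).1.nonempty_support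
      obtain ⟨M, hm, hmax⟩ := Finset.exists_max_image _ id hne
      have e := Equiv.Perm.cycle_is_cycleOf hm hc
      have hσ := Equiv.Perm.mem_cycleFactorsFinset_support_le hc hm
      refine ⟨M, ?_, e.symm⟩
      simp only [Finset.mem_filter, Finset.mem_univ, true_and]
      refine ⟨fun k => hmax _ ?_, hσ⟩
      rw [e, Equiv.Perm.mem_support_cycleOf_iff, Equiv.Perm.iterate_eq_pow]
      exact ⟨⟨k, by simp⟩, hσ⟩
  · congr 1
    ext v
    simp only [Finset.mem_compl, Finset.mem_filter, Finset.mem_univ, true_and,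
      Equiv.Perm.notMem_support]
    exact ⟨fun h => ⟨fun k => (iterate_fixed h k).le, h⟩, fun h => h.2⟩

theorem cyclesCount_eq_card_maxima {m : ℕ} (σ : Equiv.Perm (Fin m)) :
    cyclesCount σ = Nat.card {v : Fin m // ∀ k, σ^[k] v ≤ v} := by
  rw [← card_cycleType_add_eq_card_maxima, Fintype.card_fin, cyclesCount]

theorem stirC_eq_zero {a b : ℕ} (h : a < b) : stirC a b = 0 := by
  have : IsEmpty {π : Equiv.Perm (Fin a) // cyclesCount π = b} := by
    refine ⟨fun π => ?_⟩
    have h1 := π.2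
    rw [cyclesCount_eq_card_maxima] at h1
    have h2 := Finite.card_subtype_le fun v : Fin a => ∀ k, π.1^[k] v ≤ v
    rw [h1, Nat.card_eq_fintype_card, Fintype.card_fin] at h2
    omega
  exact Nat.card_of_isEmpty

/-- `stirC` counts permutations of any finite linear order by number of cycle maxima. -/
theorem card_perm_maxima_eq_stirC {α : Type*} [LinearOrder α] {a : ℕ} (e : Fin a ≃o α) (b : ℕ) :
    Nat.card {σ : Equiv.Perm α // Nat.card {v : α // ∀ k, σ^[k] v ≤ v} = b} = stirC a b := by
  symm
  refine Nat.card_congr (Equiv.subtypeEquiv e.toEquiv.permCongr fun σ => ?_)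
  rw [cyclesCount_eq_card_maxima]
  have hit (k : ℕ) (v : Fin a) : (e.toEquiv.permCongr σ)^[k] (e v) = e (σ^[k] v) := by
    induction k with
    | zero => rfl
    | succ k ih => rw [iterate_succ_apply', iterate_succ_apply', ih]; simp
  have hc : Nat.card {v : Fin a // ∀ k, σ^[k] v ≤ v} =
      Nat.card {v : α // ∀ k, (e.toEquiv.permCongr σ)^[k] v ≤ v} := by
    refine Nat.card_congr (Equiv.subtypeEquiv e.toEquiv fun v => forall_congr' fun k => ?_)
    rw [show e.toEquiv v = e v from rfl, hit, e.le_iff_le]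
  rw [hc]

end Permutations

section FunctionalGraph

open Function

variable {V : Type*}

/-- Number of cycles of `g` avoiding the set `S`, counted by their largest elements. -/
noncomputable def cyclesOff [LE V] (S : Finset V) (g : V → V) : ℕ :=
  Nat.card {v : V // v ∉ S ∧ v ∈ periodicPts g ∧ ∀ k, g^[k] v ≤ v}

/-- `h` is (the parent map of) a forest with root set `T`. -/
def IsForest (T : Set V) (h : V → V) : Prop :=
  (∀ t ∈ T, h t = t) ∧ ∀ v, ∃ k, h^[k] v ∈ T

/-- Being able to reach `T` depends only on the values outside `T`. -/
theorem exists_iterate_mem_of_eqOn_compl {T : Set V} {f g : V → V} (hfg : ∀ v ∉ T, f v = g v)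
    {v : V} (h : ∃ k, f^[k] v ∈ T) : ∃ k, g^[k] v ∈ T := by
  obtain ⟨k, hk⟩ := h
  induction k generalizing v with
  | zero => exact ⟨0, hk⟩
  | succ k ih =>
    by_cases hv : v ∈ T
    · exact ⟨0, hv⟩
    · rw [iterate_succ_apply, hfg v hv] at hk
      obtain ⟨j, hj⟩ := ih hk
      exact ⟨j + 1, hj⟩

theorem exists_iterate_mem_periodicPts [Finite V] (g : V → V) (v : V) :
    ∃ k, g^[k] v ∈ periodicPts g := by
  obtain ⟨i, j, hne, hij⟩ := Finite.exists_ne_map_eq_of_infinite fun k : ℕ => g^[k] v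
  wlog hlt : i < j generalizing i j
  · exact this j i hne.symm hij.symm (by omega)
  refine ⟨i, mk_mem_periodicPts (n := j - i) (by omega) ?_⟩
  rw [IsPeriodicPt, IsFixedPt, ← iterate_add_apply, Nat.sub_add_cancel hlt.le]
  exact hij.symm

theorem periodicPts_eq [Finite V] {T : Set V} {g : V → V} (hm : Set.MapsTo g T T)
    (hi : Set.InjOn g T) (hr : ∀ v, ∃ k, g^[k] v ∈ T) : periodicPts g = T := by
  ext v
  constructor
  · rintro ⟨m, hm0, hp⟩
    obtain ⟨k, hk⟩ := hr v
    have h1 : g^[m * (k + 1)] v = v := IsPeriodicPt.mul_const hp (k + 1)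
    have h2 : k ≤ m * (k + 1) := by nlinarith
    rw [← Nat.sub_add_cancel h2, iterate_add_apply] at h1
    rw [← h1]
    exact hm.iterate _ hk
  · intro hv
    have hinj : Injective (hm.restrict g T T) := hm.restrict_inj.mpr hi
    obtain ⟨m, hm0, hp⟩ := hinj.mem_periodicPts (⟨v, hv⟩ : T)
    refine ⟨m, hm0, ?_⟩
    have h := congrArg Subtype.val hp
    rwa [hm.iterate_restrict] at h

variable [DecidableEq V]

/-- Overwrite `h` on `U` by the permutation `σ`. -/
def glue (U : Finset V) (σ : Equiv.Perm U) (h : V → V) (v : V) : V :=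
  if hv : v ∈ U then (σ ⟨v, hv⟩ : V) else h v

theorem glue_coe {U : Finset V} (σ : Equiv.Perm U) (h : V → V) (u : U) :
    glue U σ h u = σ u := dif_pos u.2

theorem glue_of_notMem {U : Finset V} (σ : Equiv.Perm U) (h : V → V) {v : V} (hv : v ∉ U) :
    glue U σ h v = h v := dif_neg hv

theorem periodicPts_glue [Finite V] {S U : Finset V} (hSU : Disjoint S U) (σ : Equiv.Perm U)
    {h : V → V} (hh : IsForest (↑(S ∪ U)) h) :
    periodicPts (glue U σ h) = ↑(S ∪ U) := by
  have hS : ∀ s ∈ S, glue U σ h s = s := fun s hs => by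
    rw [glue_of_notMem σ h (Finset.disjoint_left.mp hSU hs)]
    exact hh.1 s (by simp [hs])
  have hU : ∀ u (hu : u ∈ U), glue U σ h u = σ ⟨u, hu⟩ := fun u hu => glue_coe σ h ⟨u, hu⟩
  refine periodicPts_eq ?_ ?_ fun v =>
    exists_iterate_mem_of_eqOn_compl (fun w hw => ?_) (hh.2 v)
  · intro v hv
    rw [Finset.mem_coe, Finset.mem_union] at hv ⊢
    rcases hv with hv | hv
    · rw [hS v hv]
      exact Or.inl hv
    · rw [hU v hv]
      exact Or.inr (σ ⟨v, hv⟩).2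
  · intro v hv w hw h
    rw [Finset.mem_coe, Finset.mem_union] at hv hw
    rcases hv with hv | hv <;> rcases hw with hw | hw
    · rwa [hS v hv, hS w hw] at h
    · rw [hS v hv, hU w hw] at h
      exact absurd (h ▸ (σ ⟨w, hw⟩).2) (Finset.disjoint_left.mp hSU hv)
    · rw [hU v hv, hS w hw] at h
      exact absurd (h ▸ (σ ⟨v, hv⟩).2) (Finset.disjoint_left.mp hSU hw)
    · rw [hU v hv, hU w hw] at h
      exact congrArg Subtype.val (σ.injective (Subtype.ext h))
  · refine (glue_of_notMem σ h fun hwU => hw ?_).symm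
    simp [hwU]

theorem bijOn_of_periodicPts_eq {S U : Finset V} (hSU : Disjoint S U) {g : V → V}
    (hS : ∀ s ∈ S, g s = s) (hp : periodicPts g = ↑(S ∪ U)) : Set.BijOn g U U := by
  have hb := bijOn_periodicPts g
  rw [hp, Finset.coe_union] at hb
  refine ⟨fun u hu => ?_, hb.injOn.mono Set.subset_union_right, fun u hu => ?_⟩
  · rcases hb.mapsTo (Set.mem_union_right _ hu) with h | h
    · have h' := hb.injOn (Set.mem_union_left _ h) (Set.mem_union_right _ hu) (hS _ h)
      rw [h'] at h
      exact absurd hu (Finset.disjoint_left.mp hSU h)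
    · exact h
  · obtain ⟨w, hw | hw, hwu⟩ := hb.surjOn (Set.mem_union_right _ hu)
    · rw [hS w hw] at hwu
      exact absurd (hwu ▸ hu) (Finset.disjoint_left.mp hSU hw)
    · exact ⟨w, hw, hwu⟩

/-- A self-map fixing `S` whose set of cyclic points is `S ∪ U` amounts to a permutation of `U`
and a forest with root set `S ∪ U`. -/
noncomputable def periodicDecomposition [Finite V] {S U : Finset V} (hSU : Disjoint S U) :
    {g : V → V // (∀ s ∈ S, g s = s) ∧ periodicPts g = ↑(S ∪ U)} ≃
      Equiv.Perm U × {h : V → V // IsForest (↑(S ∪ U)) h} where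
  toFun g :=
    (Set.BijOn.equiv g.1 (bijOn_of_periodicPts_eq hSU g.2.1 g.2.2),
      ⟨fun v => if v ∈ S ∪ U then v else g.1 v, fun t ht => if_pos ht, fun v => by
        refine exists_iterate_mem_of_eqOn_compl (fun w hw => ?_)
          (g.2.2 ▸ exists_iterate_mem_periodicPts g.1 v)
        exact (if_neg hw).symm⟩)
  invFun p := ⟨glue U p.1 p.2.1, fun s hs => by
      rw [glue_of_notMem _ _ (Finset.disjoint_left.mp hSU hs)]
      exact p.2.2.1 s (by simp [hs]), periodicPts_glue hSU p.1 p.2.2⟩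
  left_inv g := by
    refine Subtype.ext (funext fun v => ?_)
    by_cases hU : v ∈ U
    · exact glue_coe _ _ ⟨v, hU⟩
    · refine (glue_of_notMem _ _ hU).trans ?_
      by_cases hS : v ∈ S
      · simp [hS, g.2.1 v hS]
      · simp [hS, hU]
  right_inv p := by
    refine Prod.ext (Equiv.ext fun u => Subtype.ext (glue_coe _ _ u))
      (Subtype.ext (funext fun v => ?_))
    by_cases hv : v ∈ S ∪ U
    · exact (if_pos hv).trans (p.2.2.1 v hv).symm
    · refine (if_neg hv).trans (glue_of_notMem _ _ fun hU => hv ?_)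
      simp [hU]

theorem periodicDecomposition_fst_coe [Finite V] {S U : Finset V} (hSU : Disjoint S U)
    (g : {g : V → V // (∀ s ∈ S, g s = s) ∧ periodicPts g = ↑(S ∪ U)}) (u : U) :
    (((periodicDecomposition hSU g).1 u : U) : V) = g.1 u := rfl

theorem iterate_periodicDecomposition_fst_coe [Finite V] {S U : Finset V} (hSU : Disjoint S U)
    (g : {g : V → V // (∀ s ∈ S, g s = s) ∧ periodicPts g = ↑(S ∪ U)}) (k : ℕ) (u : U) :
    (((periodicDecomposition hSU g).1^[k] u : U) : V) = g.1^[k] u := by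
  induction k with
  | zero => rfl
  | succ k ih =>
    rw [iterate_succ_apply', iterate_succ_apply', periodicDecomposition_fst_coe, ih]

theorem cyclesOff_eq_card_maxima [Finite V] [LE V] {S U : Finset V} (hSU : Disjoint S U)
    (g : {g : V → V // (∀ s ∈ S, g s = s) ∧ periodicPts g = ↑(S ∪ U)}) :
    cyclesOff S g.1 =
      Nat.card {u : U // ∀ k, (periodicDecomposition hSU g).1^[k] u ≤ u} := by
  have hiff (v : V) : v ∉ S ∧ v ∈ periodicPts g.1 ↔ v ∈ U := by
    rw [g.2.2, Finset.mem_coe, Finset.mem_union]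
    exact ⟨fun h => h.2.resolve_left h.1, fun h => ⟨Finset.disjoint_right.mp hSU h, Or.inr h⟩⟩
  refine Nat.card_congr
    { toFun := fun v => ⟨⟨v.1, (hiff v.1).mp ⟨v.2.1, v.2.2.1⟩⟩, fun k => ?_⟩
      invFun := fun u => ⟨u.1.1, ((hiff u.1.1).mpr u.1.2).1, ((hiff u.1.1).mpr u.1.2).2,
        fun k => ?_⟩
      left_inv := fun v => rfl
      right_inv := fun u => rfl }
  · rw [← Subtype.coe_le_coe, iterate_periodicDecomposition_fst_coe]
    exact v.2.2.2 k
  · rw [← iterate_periodicDecomposition_fst_coe hSU g]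
    exact u.2 k

theorem card_periodicPts_eq_cyclesOff {W : Type*} [Finite W] [LinearOrder W] {S U : Finset W}
    (hSU : Disjoint S U) (ℓ : ℕ) :
    Nat.card {g : W → W // ((∀ s ∈ S, g s = s) ∧ periodicPts g = ↑(S ∪ U)) ∧
        cyclesOff S g = ℓ} =
      stirC U.card ℓ * Nat.card {h : W → W // IsForest (↑(S ∪ U)) h} := by
  rw [← card_perm_maxima_eq_stirC (U.orderIsoOfFin rfl), ← Nat.card_prod]
  refine Nat.card_congr ((Equiv.subtypeSubtypeEquivSubtypeInter _ _).symm.trans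
    ((Equiv.subtypeEquiv (periodicDecomposition hSU) fun g => ?_).trans
      (Equiv.prodSubtypeFstEquivSubtypeProd
        (p := fun σ : Equiv.Perm U => Nat.card {v : U // ∀ k, σ^[k] v ≤ v} = ℓ))))
  rw [cyclesOff_eq_card_maxima hSU g]

/-- Sort the self-maps fixing `S` by their sets of cyclic points. -/
theorem card_fixing_eq_sum [Fintype V] (S : Finset V) (P : (V → V) → Prop) :
    Nat.card {g : V → V // (∀ s ∈ S, g s = s) ∧ P g} =
      ∑ U ∈ Sᶜ.powerset,
        Nat.card {g : V → V // ((∀ s ∈ S, g s = s) ∧ periodicPts g = ↑(S ∪ U)) ∧ P g} := by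
  classical
  simp only [Nat.card_eq_fintype_card, Fintype.card_subtype]
  rw [Finset.card_eq_sum_card_fiberwise
    (f := fun g : V → V => (periodicPts g).toFinset \ S) (t := Sᶜ.powerset)]
  · refine Finset.sum_congr rfl fun U hU => ?_
    congr 1
    ext g
    simp only [Finset.mem_filter, Finset.mem_univ, true_and]
    have hU' : Disjoint U S := by
      rw [Finset.mem_powerset] at hU
      exact Finset.disjoint_left.mpr fun x hx => Finset.mem_compl.mp (hU hx)
    have hper (hg : ∀ s ∈ S, g s = s) :
        (periodicPts g).toFinset \ S = U ↔ periodicPts g = ↑(S ∪ U) := by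
      have hsub : S ⊆ (periodicPts g).toFinset := fun s hs => by
        rw [Set.mem_toFinset]
        exact mk_mem_periodicPts one_pos (hg s hs)
      rw [← Set.coe_toFinset (periodicPts g), Finset.coe_inj, Finset.toFinset_coe]
      constructor
      · rintro rfl
        exact (Finset.union_sdiff_of_subset hsub).symm
      · intro h
        rw [h, Finset.union_sdiff_cancel_left hU'.symm]
    constructor
    · rintro ⟨⟨h1, h2⟩, h3⟩
      exact ⟨⟨h1, (hper h1).mp h3⟩, h2⟩
    · rintro ⟨⟨h1, h3⟩, h2⟩
      exact ⟨⟨h1, h2⟩, (hper h1).mpr h3⟩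
  · intro g _
    simp only [Finset.mem_coe, Finset.mem_powerset]
    exact fun x hx => Finset.mem_compl.mpr (Finset.mem_sdiff.mp hx).2

theorem card_fixing [Fintype V] (S : Finset V) :
    Nat.card {g : V → V // ∀ s ∈ S, g s = s} = Fintype.card V ^ (Sᶜ).card := by
  have e : {g : V → V // ∀ s ∈ S, g s = s} ≃ (↥Sᶜ → V) :=
    { toFun := fun g v => g.1 v
      invFun := fun f => ⟨fun v => if h : v ∈ S then v else f ⟨v, Finset.mem_compl.mpr h⟩,
        fun s hs => dif_pos hs⟩
      left_inv := fun g => by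
        refine Subtype.ext (funext fun v => ?_)
        by_cases h : v ∈ S
        · simp [h, g.2 v h]
        · simp [h]
      right_inv := fun f => by
        refine funext fun v => ?_
        simp [Finset.mem_compl.mp v.2] }
  rw [Nat.card_congr e, Nat.card_eq_fintype_card, Fintype.card_fun, Fintype.card_coe]

theorem sum_descFactorial_mul_pow (q m : ℕ) :
    ∑ j ∈ Finset.range (m + 1), m.descFactorial j * (q + j) * (q + m) ^ (m - j) =
      (q + m) ^ (m + 1) := by
  induction m generalizing q with
  | zero => simp
  | succ m ih =>
    rw [Finset.sum_range_succ']
    have h (j : ℕ) : (m + 1).descFactorial (j + 1) * (q + (j + 1)) *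
        (q + (m + 1)) ^ (m + 1 - (j + 1)) =
        (m + 1) * (m.descFactorial j * (q + 1 + j) * (q + 1 + m) ^ (m - j)) := by
      rw [Nat.succ_descFactorial_succ, Nat.add_sub_add_right, show q + (m + 1) = q + 1 + m by ring,
        show q + (j + 1) = q + 1 + j by ring]
      ring
    simp only [h]
    rw [← Finset.mul_sum, ih (q + 1), Nat.descFactorial_zero, Nat.sub_zero]
    ring

/-- Cayley's formula for rooted forests. -/
theorem card_forest_mul [Fintype V] [Nonempty V] (T : Finset V) :
    Nat.card {h : V → V // IsForest (T : Set V) h} * Fintype.card V =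
      T.card * Fintype.card V ^ Tᶜ.card := by
  induction hm : Tᶜ.card using Nat.strong_induction_on generalizing T with
  | _ m ih =>
  have hN : Fintype.card V = T.card + m := by rw [← hm, Finset.card_add_card_compl]
  have hdecomp := card_fixing_eq_sum T fun _ => True
  simp only [and_true] at hdecomp
  have hterm : ∀ U ∈ Tᶜ.powerset,
      Nat.card {g : V → V // (∀ s ∈ T, g s = s) ∧ periodicPts g = ↑(T ∪ U)} * Fintype.card V =
      U.card.factorial *
        (Nat.card {h : V → V // IsForest (↑(T ∪ U)) h} * Fintype.card V) := by
    intro U hU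
    have hd : Disjoint T U := Finset.disjoint_left.mpr fun x hx hxU =>
      Finset.mem_compl.mp (Finset.mem_powerset.mp hU hxU) hx
    rw [Nat.card_congr (periodicDecomposition hd), Nat.card_prod, Nat.card_perm,
      Nat.card_eq_fintype_card, Fintype.card_coe, mul_assoc]
  have hsum : Fintype.card V ^ (m + 1) = ∑ U ∈ Tᶜ.powerset, U.card.factorial *
      (Nat.card {h : V → V // IsForest (↑(T ∪ U)) h} * Fintype.card V) := by
    rw [← Finset.sum_congr rfl hterm, ← Finset.sum_mul, ← hdecomp, card_fixing, hm, pow_succ]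
  have hsum' : Fintype.card V ^ (m + 1) = ∑ U ∈ Tᶜ.powerset, U.card.factorial *
      ((T.card + U.card) * Fintype.card V ^ (m - U.card)) := by
    rw [Finset.sum_powerset_apply_card fun j => j.factorial *
      ((T.card + j) * Fintype.card V ^ (m - j)), hm, hN, ← sum_descFactorial_mul_pow]
    refine Finset.sum_congr rfl fun j _ => ?_
    rw [Nat.descFactorial_eq_factorial_mul_choose, smul_eq_mul]
    ring
  have hempty : (∅ : Finset V) ∈ Tᶜ.powerset := Finset.empty_mem_powerset _
  rw [← Finset.add_sum_erase _ _ hempty] at hsum hsum'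
  have hrest : ∑ U ∈ Tᶜ.powerset.erase ∅, U.card.factorial *
      (Nat.card {h : V → V // IsForest (↑(T ∪ U)) h} * Fintype.card V) =
      ∑ U ∈ Tᶜ.powerset.erase ∅, U.card.factorial *
        ((T.card + U.card) * Fintype.card V ^ (m - U.card)) := by
    refine Finset.sum_congr rfl fun U hU => ?_
    obtain ⟨hne, hU⟩ := Finset.mem_erase.mp hU
    have hsub := Finset.mem_powerset.mp hU
    have hd : Disjoint T U := Finset.disjoint_left.mpr fun x hx hxU =>
      Finset.mem_compl.mp (hsub hxU) hx
    have hpos := Finset.card_pos.mpr (Finset.nonempty_iff_ne_empty.mpr hne)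
    have hle := Finset.card_le_card hsub
    have hc : (T ∪ U)ᶜ.card = m - U.card := by
      rw [Finset.card_compl, Finset.card_union_of_disjoint hd]
      omega
    rw [ih (m - U.card) (by omega) (T ∪ U) hc, Finset.card_union_of_disjoint hd]
  rw [hrest] at hsum
  simpa using Nat.add_right_cancel (hsum.symm.trans hsum')

theorem card_fixing_cyclesOff_mul {W : Type*} [Fintype W] [LinearOrder W] [Nonempty W]
    (S : Finset W) (ℓ : ℕ) :
    Nat.card {g : W → W // (∀ s ∈ S, g s = s) ∧ cyclesOff S g = ℓ} * Fintype.card W =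
      ∑ j ∈ Finset.range (Sᶜ.card + 1),
        Sᶜ.card.choose j * stirC j ℓ * (S.card + j) * Fintype.card W ^ (Sᶜ.card - j) := by
  have hterm : ∀ U ∈ Sᶜ.powerset,
      Nat.card {g : W → W // ((∀ s ∈ S, g s = s) ∧ periodicPts g = ↑(S ∪ U)) ∧
        cyclesOff S g = ℓ} * Fintype.card W =
      stirC U.card ℓ * ((S.card + U.card) * Fintype.card W ^ (Sᶜ.card - U.card)) := by
    intro U hU
    have hd : Disjoint S U := Finset.disjoint_left.mpr fun x hx hxU =>
      Finset.mem_compl.mp (Finset.mem_powerset.mp hU hxU) hx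
    rw [card_periodicPts_eq_cyclesOff hd, mul_assoc, card_forest_mul,
      Finset.card_union_of_disjoint hd, Finset.card_compl, Finset.card_compl,
      Finset.card_union_of_disjoint hd, Nat.sub_sub]
  rw [card_fixing_eq_sum, Finset.sum_mul, Finset.sum_congr rfl hterm,
    Finset.sum_powerset_apply_card fun j =>
      stirC j ℓ * ((S.card + j) * Fintype.card W ^ (Sᶜ.card - j))]
  refine Finset.sum_congr rfl fun j _ => ?_
  rw [smul_eq_mul]
  ring

end FunctionalGraph

section RecordTransform

open Function

variable {n : ℕ}

/-- The orbit of a nonzero vertex attains its maximum at the first record it meets. -/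
theorem exists_first_record {f : Fin (n + 1) → Fin (n + 1)} {v : Fin (n + 1)}
    (hv : v ≠ 0) :
    ∃ j, IsRec0 f (f^[j] v) ∧ (∀ i < j, ¬ IsRec0 f (f^[i] v)) ∧ ∀ k, f^[k] v ≤ f^[j] v := by
  classical
  obtain ⟨M, ⟨m, rfl⟩, hM⟩ := Set.exists_max_image (Set.range fun k => f^[k] v) id
    (Set.toFinite _) ⟨v, 0, rfl⟩
  have hM' : ∀ k, f^[k] v ≤ f^[m] v := fun k => hM _ ⟨k, rfl⟩
  have hrec : IsRec0 f (f^[m] v) := by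
    refine ⟨fun h => hv ?_, fun k => ?_⟩
    · have := hM' 0
      rw [h] at this
      exact Fin.le_zero_iff.mp this
    · rw [← iterate_add_apply]
      exact hM' _
  have hex : ∃ j, IsRec0 f (f^[j] v) := ⟨m, hrec⟩
  refine ⟨Nat.find hex, Nat.find_spec hex, fun i hi => Nat.find_min hex hi, fun k => ?_⟩
  refine (hM' k).trans ?_
  have h := (Nat.find_spec hex).2 (m - Nat.find hex)
  rwa [← iterate_add_apply, Nat.sub_add_cancel (Nat.find_min' hex hrec)] at h

theorem iterate_eq_of_avoid {α : Type*} {f g : α → α} {R : α → Prop}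
    (hfg : ∀ v, ¬ R v → g v = f v) {v : α} {j : ℕ} (h : ∀ i < j, ¬ R (f^[i] v)) :
    g^[j] v = f^[j] v := by
  induction j with
  | zero => rfl
  | succ j ih =>
    rw [iterate_succ_apply', iterate_succ_apply', ih fun i hi => h i (by omega),
      hfg _ (h j (by omega))]

/-- As `exists_first_record`, with a map `g` following the orbit up to the first record. -/
theorem exists_common_record {f g : Fin (n + 1) → Fin (n + 1)}
    (hfg : ∀ v, ¬ IsRec0 f v → g v = f v) {v : Fin (n + 1)} (hv : v ≠ 0) :
    ∃ j, IsRec0 f (f^[j] v) ∧ g^[j] v = f^[j] v ∧ ∀ k, f^[k] v ≤ f^[j] v := by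
  obtain ⟨j, h1, h2, h3⟩ := exists_first_record (f := f) hv
  exact ⟨j, h1, iterate_eq_of_avoid hfg h2, h3⟩

theorem isRec0_of_agree {f g : Fin (n + 1) → Fin (n + 1)}
    (hfg : ∀ v, ¬ IsRec0 f v → g v = f v) {v : Fin (n + 1)} (hv : IsRec0 g v) :
    IsRec0 f v := by
  by_contra hn
  obtain ⟨j, h1, h2, h3⟩ := exists_common_record hfg hv.1
  have h4 := hv.2 j
  rw [h2] at h4
  rw [le_antisymm h4 (h3 0)] at h1
  exact hn h1

theorem isRec0_of_invariant {g : Fin (n + 1) → Fin (n + 1)} {r : Fin (n + 1)} (hr : r ≠ 0)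
    (Q : Fin (n + 1) → Prop) (hQr : Q r) (hQ : ∀ w, Q w → w ≤ r) (hQg : ∀ w, Q w → Q (g w)) :
    IsRec0 g r := by
  refine ⟨hr, fun k => hQ _ ?_⟩
  induction k with
  | zero => exact hQr
  | succ k ih => rw [iterate_succ_apply']; exact hQg _ ih

theorem isRec0_last {f : Fin (n + 1) → Fin (n + 1)} (hn : n ≠ 0) : IsRec0 f (Fin.last n) :=
  ⟨by simpa [Fin.ext_iff] using hn, fun _ => Fin.le_last _⟩

open Classical in
/-- The least element above `v` satisfying `R` (the last vertex if there is none). -/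
noncomputable def nextIn (R : Fin (n + 1) → Prop) (v : Fin (n + 1)) : Fin (n + 1) :=
  if h : (Finset.univ.filter fun w => R w ∧ v < w).Nonempty then Finset.min' _ h else Fin.last n

open Classical in
/-- The greatest element below `v` satisfying `R` (`0` if there is none). -/
noncomputable def prevIn (R : Fin (n + 1) → Prop) (v : Fin (n + 1)) : Fin (n + 1) :=
  if h : (Finset.univ.filter fun w => R w ∧ w < v).Nonempty then Finset.max' _ h else 0

theorem nextIn_spec {R : Fin (n + 1) → Prop} {v : Fin (n + 1)} (hR : R (Fin.last n))
    (hv : v ≠ Fin.last n) :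
    R (nextIn R v) ∧ v < nextIn R v ∧ ∀ w, R w → v < w → nextIn R v ≤ w := by
  classical
  have h : (Finset.univ.filter fun w => R w ∧ v < w).Nonempty :=
    ⟨Fin.last n, by simp [hR, Fin.lt_last_iff_ne_last, hv]⟩
  have e : nextIn R v = Finset.min' _ h := dif_pos h
  rw [e]
  have hm := Finset.min'_mem _ h
  simp only [Finset.mem_filter, Finset.mem_univ, true_and] at hm
  exact ⟨hm.1, hm.2, fun w h1 h2 => Finset.min'_le _ _ (by simp [h1, h2])⟩

theorem prevIn_spec {R : Fin (n + 1) → Prop} {v : Fin (n + 1)} (hv : v ≠ 0) :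
    (R (prevIn R v) ∨ prevIn R v = 0) ∧ prevIn R v < v ∧
      ∀ w, R w → w < v → w ≤ prevIn R v := by
  classical
  by_cases h : (Finset.univ.filter fun w => R w ∧ w < v).Nonempty
  · have e : prevIn R v = Finset.max' _ h := dif_pos h
    rw [e]
    have hm := Finset.max'_mem _ h
    simp only [Finset.mem_filter, Finset.mem_univ, true_and] at hm
    exact ⟨Or.inl hm.1, hm.2, fun w h1 h2 => Finset.le_max' _ _ (by simp [h1, h2])⟩
  · have e : prevIn R v = 0 := dif_neg h
    rw [e]
    refine ⟨Or.inr rfl, Fin.pos_iff_ne_zero.mpr hv, fun w h1 h2 => (h ⟨w, ?_⟩).elim⟩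
    simp [h1, h2]

theorem prevIn_nextIn {R : Fin (n + 1) → Prop} {v : Fin (n + 1)} (hR : R (Fin.last n))
    (hv : v ≠ Fin.last n) (hRv : R v) : prevIn R (nextIn R v) = v := by
  obtain ⟨h1, h2, h3⟩ := nextIn_spec hR hv
  obtain ⟨h4, h5, h6⟩ := prevIn_spec (R := R) (v := nextIn R v) (Fin.ne_zero_of_lt h2)
  refine le_antisymm ?_ (h6 v hRv h2)
  by_contra! h
  rcases h4 with h4 | h4
  · exact absurd (h3 _ h4 h) (not_le.mpr h5)
  · rw [h4] at h
    exact absurd h (Fin.not_lt_zero _)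

theorem nextIn_prevIn {R : Fin (n + 1) → Prop} {v : Fin (n + 1)} (hR : R (Fin.last n))
    (hv : v ≠ 0) (hRv : R v) : nextIn R (prevIn R v) = v := by
  obtain ⟨h4, h5, h6⟩ := prevIn_spec (R := R) hv
  obtain ⟨h1, h2, h3⟩ := nextIn_spec (R := R) (v := prevIn R v) hR
    (h5.trans_le (Fin.le_last _)).ne
  refine le_antisymm (h3 v hRv h5) ?_
  by_contra! h
  exact absurd (h6 _ h1 h) (not_le.mpr h2)

/-- Trees rooted at `0`, given by their parent maps. -/
def IsRootedTree (f : Fin (n + 1) → Fin (n + 1)) : Prop :=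
  f 0 = 0 ∧ ∀ v, ∃ k, f^[k] v = 0

open Classical in
/-- Send every record to the parent of the next record, and fix the last vertex. -/
noncomputable def recordShift (f : Fin (n + 1) → Fin (n + 1)) (v : Fin (n + 1)) : Fin (n + 1) :=
  if v = Fin.last n then v else if IsRec0 f v then f (nextIn (IsRec0 f) v) else f v

open Classical in
/-- Send every record to the image of the previous record. -/
noncomputable def recordUnshift (g : Fin (n + 1) → Fin (n + 1)) (v : Fin (n + 1)) :
    Fin (n + 1) :=
  if IsRec0 g v then g (prevIn (IsRec0 g) v) else g v

theorem iterate_eq_zero {f : Fin (n + 1) → Fin (n + 1)} (h0 : f 0 = 0) (k : ℕ) :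
    f^[k] 0 = 0 := iterate_fixed h0 k

theorem IsRootedTree.iterate_succ_ne {f : Fin (n + 1) → Fin (n + 1)} (hf : IsRootedTree f)
    {v : Fin (n + 1)} (hv : v ≠ 0) (j : ℕ) : f^[j + 1] v ≠ v := by
  intro h
  obtain ⟨k, hk⟩ := hf.2 v
  have hp : IsPeriodicPt f ((j + 1) * k) v :=
    IsPeriodicPt.mul_const h k
  apply hv
  rw [← hp, show (j + 1) * k = j * k + k by ring, iterate_add_apply, hk, iterate_eq_zero hf.1]

section Shift

variable {f : Fin (n + 1) → Fin (n + 1)}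

theorem recordShift_of_not_isRec0 (hn : n ≠ 0) {v : Fin (n + 1)} (hv : ¬ IsRec0 f v) :
    recordShift f v = f v := by
  have h : v ≠ Fin.last n := by
    rintro rfl
    exact hv (isRec0_last hn)
  simp [recordShift, h, hv]

theorem recordShift_of_isRec0 {v : Fin (n + 1)} (hl : v ≠ Fin.last n) (hv : IsRec0 f v) :
    recordShift f v = f (nextIn (IsRec0 f) v) := by
  simp [recordShift, hl, hv]

theorem recordShift_last : recordShift f (Fin.last n) = Fin.last n := by
  simp [recordShift]

theorem recordShift_zero (hn : n ≠ 0) (hf : f 0 = 0) : recordShift f 0 = 0 := by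
  rw [recordShift_of_not_isRec0 hn (fun h => h.1 rfl), hf]

theorem iterate_recordShift_orbit_le (hn : n ≠ 0) (hf : IsRootedTree f) {r : Fin (n + 1)}
    (hl : r ≠ Fin.last n) (hr : IsRec0 f r) (k : ℕ) : f^[k] (recordShift f r) ≤ r := by
  rw [recordShift_of_isRec0 hl hr]
  obtain ⟨h1, h2, h3⟩ := nextIn_spec (R := IsRec0 f) (isRec0_last hn) hl
  generalize nextIn (IsRec0 f) r = s at *
  by_cases hu : f s = 0
  · rw [hu, iterate_eq_zero hf.1]
    exact Fin.zero_le _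
  · obtain ⟨j, h4, -, h5⟩ := exists_first_record (f := f) hu
    refine (h5 k).trans ?_
    by_contra! h
    have h6 := h3 _ h4 h
    rw [← iterate_succ_apply] at h6
    exact hf.iterate_succ_ne h1.1 j (le_antisymm (h1.2 _) h6)

theorem isRec0_recordShift_iff (hn : n ≠ 0) (hf : IsRootedTree f) (r : Fin (n + 1)) :
    IsRec0 (recordShift f) r ↔ IsRec0 f r := by
  refine ⟨isRec0_of_agree fun v hv => recordShift_of_not_isRec0 hn hv, fun hr => ?_⟩
  refine isRec0_of_invariant hr.1 (fun w => ∀ k, f^[k] w ≤ r) hr.2 (fun w h => h 0) ?_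
  intro w hw k
  by_cases hwr : IsRec0 f w
  · by_cases hl : w = Fin.last n
    · rw [hl, recordShift_last, ← hl]
      exact hw k
    · exact (iterate_recordShift_orbit_le hn hf hl hwr k).trans (hw 0)
  · rw [recordShift_of_not_isRec0 hn hwr, ← iterate_succ_apply]
    exact hw _

theorem recordUnshift_recordShift (hn : n ≠ 0) (hf : IsRootedTree f) :
    recordUnshift (recordShift f) = f := by
  have hR : IsRec0 (recordShift f) = IsRec0 f :=
    funext fun r => propext (isRec0_recordShift_iff hn hf r)
  funext v
  unfold recordUnshift
  rw [hR]
  split_ifs with hv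
  · obtain ⟨h1, h2, h3⟩ := prevIn_spec (R := IsRec0 f) hv.1
    have hl : prevIn (IsRec0 f) v ≠ Fin.last n := (h2.trans_le (Fin.le_last _)).ne
    rcases h1 with h1 | h1
    · rw [recordShift_of_isRec0 hl h1, nextIn_prevIn (isRec0_last hn) hv.1 hv]
    · rw [h1, recordShift_zero hn hf.1]
      by_contra hne
      have hu : f v ≠ 0 := Ne.symm hne
      obtain ⟨j, h4, -, h5⟩ := exists_first_record (f := f) hu
      have h6 : f^[j] (f v) < v := lt_of_le_of_ne
        (by rw [← iterate_succ_apply]; exact hv.2 _)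
        (by rw [← iterate_succ_apply]; exact hf.iterate_succ_ne hv.1 j)
      have h7 := h3 _ h4 h6
      rw [h1] at h7
      exact h4.1 (Fin.le_zero_iff.mp h7)
  · exact recordShift_of_not_isRec0 hn hv

/-- The record `r` is an ancestor of the next record exactly when it is a cyclic point of the
shifted map. -/
theorem exists_iterate_nextIn_iff (hn : n ≠ 0) (hf : IsRootedTree f) {r : Fin (n + 1)}
    (hl : r ≠ Fin.last n) (hr : IsRec0 f r) :
    (∃ k, f^[k] (nextIn (IsRec0 f) r) = r) ↔ r ∈ periodicPts (recordShift f) := by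
  have hle := iterate_recordShift_orbit_le hn hf hl hr
  have hs := recordShift_of_isRec0 hl hr
  obtain ⟨-, hlt, -⟩ := nextIn_spec (R := IsRec0 f) (isRec0_last hn) hl
  have hagree : ∀ v, ¬ IsRec0 f v → recordShift f v = f v :=
    fun v hv => recordShift_of_not_isRec0 hn hv
  constructor
  · rintro ⟨k, hk⟩
    obtain _ | k := k
    · exact absurd hk hlt.ne'
    rw [iterate_succ_apply, ← hs] at hk
    have hu : recordShift f r ≠ 0 := by
      intro h
      rw [h, iterate_eq_zero hf.1] at hk
      exact hr.1 hk.symm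
    obtain ⟨j, h1, h2, h3⟩ := exists_common_record hagree hu
    have h4 := h3 k
    rw [hk] at h4
    refine mk_mem_periodicPts (Nat.succ_pos j) ?_
    rw [IsPeriodicPt, IsFixedPt, iterate_succ_apply, h2]
    exact le_antisymm (hle j) h4
  · rintro ⟨m, hm, hp⟩
    obtain ⟨m, rfl⟩ := Nat.exists_eq_succ_of_ne_zero hm.ne'
    have hu : recordShift f r ≠ 0 := by
      intro h
      have h' := hp
      rw [IsPeriodicPt, IsFixedPt, iterate_succ_apply, h,
        iterate_eq_zero (recordShift_zero hn hf.1)] at h'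
      exact hr.1 h'.symm
    obtain ⟨j, h1, h2, h3⟩ := exists_common_record hagree hu
    refine ⟨j + 1, ?_⟩
    rw [iterate_succ_apply, ← hs]
    refine le_antisymm (hle j) ?_
    have h4 : IsRec0 (recordShift f) (f^[j] (recordShift f r)) :=
      (isRec0_recordShift_iff hn hf _).mpr h1
    have h5 := h4.2 (m * (j + 1))
    have h6 := IsPeriodicPt.mul_const hp (j + 1)
    rw [show m.succ * (j + 1) = m * (j + 1) + (j + 1) by rw [Nat.succ_mul]] at h6
    rw [← h2, ← iterate_succ_apply, ← iterate_add_apply, h6] at h5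
    rwa [← h2, ← iterate_succ_apply]

theorem drc_iff (hn : n ≠ 0) (r s : Fin (n + 1)) :
    DRC f r s ↔ IsRec0 f r ∧ r ≠ Fin.last n ∧ s = nextIn (IsRec0 f) r ∧
      ∃ k, f^[k] (nextIn (IsRec0 f) r) = r := by
  constructor
  · rintro ⟨h1, h2, h3, h4, h5⟩
    have hl : r ≠ Fin.last n := (h4.trans_le (Fin.le_last _)).ne
    obtain ⟨h6, h7, h8⟩ := nextIn_spec (R := IsRec0 f) (isRec0_last hn) hl
    have e : s = nextIn (IsRec0 f) r := le_antisymm (h5 _ h6 h7) (h8 _ h2 h4)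
    exact ⟨h1, hl, e, e ▸ h3⟩
  · rintro ⟨h1, hl, rfl, h3⟩
    obtain ⟨h6, h7, h8⟩ := nextIn_spec (R := IsRec0 f) (isRec0_last hn) hl
    exact ⟨h1, h6, h3, h7, h8⟩

end Shift

theorem card_drc_eq {f : Fin (n + 1) → Fin (n + 1)} (hn : n ≠ 0) (hf : IsRootedTree f) :
    Nat.card {p : Fin (n + 1) × Fin (n + 1) // DRC f p.1 p.2} =
      cyclesOff {0, Fin.last n} (recordShift f) := by
  have key (r : Fin (n + 1)) : (r ∉ ({0, Fin.last n} : Finset (Fin (n + 1))) ∧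
      r ∈ periodicPts (recordShift f) ∧ ∀ k, (recordShift f)^[k] r ≤ r) ↔
      DRC f r (nextIn (IsRec0 f) r) := by
    rw [drc_iff hn]
    have h := isRec0_recordShift_iff hn hf r
    simp only [Finset.mem_insert, Finset.mem_singleton, not_or]
    constructor
    · rintro ⟨⟨h0, hl⟩, hp, hm⟩
      have hr := h.mp ⟨h0, hm⟩
      exact ⟨hr, hl, trivial, (exists_iterate_nextIn_iff hn hf hl hr).mpr hp⟩
    · rintro ⟨hr, hl, -, hp⟩
      exact ⟨⟨hr.1, hl⟩, (exists_iterate_nextIn_iff hn hf hl hr).mp hp, (h.mpr hr).2⟩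
  refine Nat.card_congr
    { toFun := fun p => ⟨p.1.1, (key _).mpr ?_⟩
      invFun := fun r => ⟨(r.1, nextIn (IsRec0 f) r.1), (key _).mp r.2⟩
      left_inv := fun p => ?_
      right_inv := fun r => rfl }
  · have h := p.2
    rwa [((drc_iff hn _ _).mp p.2).2.2.1] at h
  · exact Subtype.ext (Prod.ext rfl ((drc_iff hn _ _).mp p.2).2.2.1.symm)

section Unshift

variable {g : Fin (n + 1) → Fin (n + 1)}

theorem recordUnshift_of_not_isRec0 {v : Fin (n + 1)} (hv : ¬ IsRec0 g v) :
    recordUnshift g v = g v := by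
  simp [recordUnshift, hv]

theorem recordUnshift_of_isRec0 {v : Fin (n + 1)} (hv : IsRec0 g v) :
    recordUnshift g v = g (prevIn (IsRec0 g) v) := by
  simp [recordUnshift, hv]

theorem iterate_recordUnshift_orbit_lt (h0 : g 0 = 0) {r : Fin (n + 1)} (hr : IsRec0 g r)
    (k : ℕ) : g^[k] (recordUnshift g r) < r := by
  rw [recordUnshift_of_isRec0 hr, ← iterate_succ_apply]
  obtain ⟨h1, h2, -⟩ := prevIn_spec (R := IsRec0 g) hr.1
  rcases h1 with h1 | h1
  · exact (h1.2 _).trans_lt h2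
  · rw [h1, iterate_eq_zero h0]
    exact Fin.pos_iff_ne_zero.mpr hr.1

theorem isRec0_recordUnshift_iff (h0 : g 0 = 0) (r : Fin (n + 1)) :
    IsRec0 (recordUnshift g) r ↔ IsRec0 g r := by
  refine ⟨isRec0_of_agree fun v hv => recordUnshift_of_not_isRec0 hv, fun hr => ?_⟩
  refine isRec0_of_invariant hr.1 (fun w => ∀ k, g^[k] w ≤ r) hr.2 (fun w h => h 0) ?_
  intro w hw k
  by_cases hwr : IsRec0 g w
  · exact (iterate_recordUnshift_orbit_lt h0 hwr k).le.trans (hw 0)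
  · rw [recordUnshift_of_not_isRec0 hwr, ← iterate_succ_apply]
    exact hw _

theorem isRootedTree_recordUnshift (h0 : g 0 = 0) : IsRootedTree (recordUnshift g) := by
  have hz : recordUnshift g 0 = 0 := by
    rw [recordUnshift_of_not_isRec0 fun h => h.1 rfl, h0]
  have step (B : Fin (n + 1) → Prop)
      (hB : ∀ r, IsRec0 g r → B r → ∃ k, (recordUnshift g)^[k] r = 0)
      (v : Fin (n + 1)) (hv : ∀ k, B (g^[k] v)) : ∃ k, (recordUnshift g)^[k] v = 0 := by
    by_cases h : v = 0
    · exact ⟨0, h⟩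
    · obtain ⟨j, h1, h2, -⟩ := exists_common_record
        (fun v hv => recordUnshift_of_not_isRec0 (g := g) hv) h
      obtain ⟨k, hk⟩ := hB _ h1 (hv j)
      exact ⟨k + j, by rw [iterate_add_apply, h2, hk]⟩
  have hrec (r : Fin (n + 1)) : IsRec0 g r → ∃ k, (recordUnshift g)^[k] r = 0 := by
    induction r using WellFoundedLT.induction with
    | ind r ih =>
      intro hr
      obtain ⟨k, hk⟩ := step (· < r) (fun s hs hlt => ih s hlt hs) (recordUnshift g r)
        (iterate_recordUnshift_orbit_lt h0 hr)
      exact ⟨k + 1, hk⟩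
  exact ⟨hz, fun v => step (fun _ => True) (fun r hr _ => hrec r hr) v fun _ => trivial⟩

theorem recordShift_recordUnshift (hn : n ≠ 0) (h0 : g 0 = 0)
    (hl : g (Fin.last n) = Fin.last n) : recordShift (recordUnshift g) = g := by
  have hR : IsRec0 (recordUnshift g) = IsRec0 g :=
    funext fun r => propext (isRec0_recordUnshift_iff h0 r)
  funext v
  unfold recordShift
  rw [hR]
  split_ifs with h1 h2
  · rw [h1, hl]
  · obtain ⟨h3, -, -⟩ := nextIn_spec (R := IsRec0 g) (isRec0_last hn) h1
    rw [recordUnshift_of_isRec0 h3, prevIn_nextIn (isRec0_last hn) h1 h2]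
  · exact recordUnshift_of_not_isRec0 h2

end Unshift

/-- Trees with `ℓ` doubly record-covering pairs are equinumerous with maps that fix `0` and the
last vertex and have `ℓ` further cycles. -/
theorem card_trees_eq_card_maps (hn : n ≠ 0) (ℓ : ℕ) :
    Nat.card {f : Fin (n + 1) → Fin (n + 1) // f 0 = 0 ∧ (∀ v, ∃ k, f^[k] v = 0) ∧
        Nat.card {p : Fin (n + 1) × Fin (n + 1) // DRC f p.1 p.2} = ℓ} =
      Nat.card {g : Fin (n + 1) → Fin (n + 1) //
        (∀ s ∈ ({0, Fin.last n} : Finset (Fin (n + 1))), g s = s) ∧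
        cyclesOff {0, Fin.last n} g = ℓ} := by
  refine Nat.card_congr
    { toFun := fun f => ⟨recordShift f.1, ?_, ?_⟩
      invFun := fun g => ⟨recordUnshift g.1, ?_⟩
      left_inv := fun f => Subtype.ext (recordUnshift_recordShift hn ⟨f.2.1, f.2.2.1⟩)
      right_inv := fun g => Subtype.ext
        (recordShift_recordUnshift hn (g.2.1 _ (by simp)) (g.2.1 _ (by simp))) }
  · intro s hs
    rw [Finset.mem_insert, Finset.mem_singleton] at hs
    rcases hs with rfl | rfl
    · exact recordShift_zero hn f.2.1
    · exact recordShift_last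
  · rw [← card_drc_eq hn ⟨f.2.1, f.2.2.1⟩]
    exact f.2.2.2
  · have h0 : g.1 0 = 0 := g.2.1 _ (by simp)
    have hl : g.1 (Fin.last n) = Fin.last n := g.2.1 _ (by simp)
    have ht := isRootedTree_recordUnshift h0
    refine ⟨ht.1, ht.2, ?_⟩
    rw [card_drc_eq hn ht, recordShift_recordUnshift hn h0 hl]
    exact g.2.2

end RecordTransform

/-- The number of rooted trees on `{0,1,…,n}` rooted at `0` with exactly `ℓ`
doubly record-covering pairs equals
`Σ_{q=ℓ+2}^{n+1} C(n-1,q-2)·c(q-2,ℓ)·q·(n+1)^(n-q)`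
(stated multiplied through by `n+1`, so the exponent becomes `n+1-q`). -/
theorem stmt18 (n ℓ : ℕ) (hn : 2 ≤ n) :
    Nat.card {f : Fin (n + 1) → Fin (n + 1) //
        f 0 = 0 ∧ (∀ v, ∃ k, f^[k] v = 0) ∧
        Nat.card {p : Fin (n + 1) × Fin (n + 1) // DRC f p.1 p.2} = ℓ} * (n + 1) =
      ∑ q ∈ Finset.Icc (ℓ + 2) (n + 1),
        (n - 1).choose (q - 2) * stirC (q - 2) ℓ * q * (n + 1) ^ (n + 1 - q) := by
  rw [card_trees_eq_card_maps (by omega)]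
  have hcard : ({0, Fin.last n} : Finset (Fin (n + 1))).card = 2 :=
    Finset.card_pair (by simp [Fin.ext_iff]; omega)
  have h := card_fixing_cyclesOff_mul ({0, Fin.last n} : Finset (Fin (n + 1))) ℓ
  rw [Finset.card_compl, hcard, Fintype.card_fin, show n + 1 - 2 = n - 1 by omega] at h
  rw [h]
  have hinj : Set.InjOn (· + 2) (Finset.range (n - 1 + 1) : Set ℕ) :=
    fun a _ b _ hab => Nat.add_right_cancel hab
  have himage : Finset.Icc (ℓ + 2) (n + 1) ⊆ (Finset.range (n - 1 + 1)).image (· + 2) := by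
    intro q hq
    rw [Finset.mem_Icc] at hq
    exact Finset.mem_image.mpr ⟨q - 2, Finset.mem_range.mpr (by omega), by omega⟩
  rw [Finset.sum_subset himage, Finset.sum_image hinj]
  · refine Finset.sum_congr rfl fun j _ => ?_
    rw [Nat.add_sub_cancel, add_comm 2 j, show n + 1 - (j + 2) = n - 1 - j by omega]
  · intro q hq hq'
    obtain ⟨j, hj, rfl⟩ := Finset.mem_image.mp hq
    rw [Finset.mem_range] at hj
    rw [Finset.mem_Icc] at hq'
    simp [stirC_eq_zero (show j < ℓ by omega)]
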